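/- arXiv:1401.6863 — 2 statements merged into one kernel-verified Lean document; each statement's English description precedes it below -/
import Mathlib

section
/- Let 0 < α < 1. There is a constant C = C(α) > 0 such that for every square Q ⊂ ℝ² with side length ℓ > 0, every smooth compactly supported function f : ℝ² → ℝ with support contained in Q and ‖Δf‖_{L¹(ℝ²)} ≤ 1, and each i ∈ {1, 2}: ∫_{ℝ²} |((∂_i Δf) * k_α)(y)| dy ≤ C · ℓ^α, where k_α(x) = |x|^{α−1} and * denotes convolution. -/
open scoped BigOperators

noncomputable section

/-- Partial derivative in the `i`-th coordinate direction. -/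
def pderiv2 (i : Fin 2) (f : EuclideanSpace ℝ (Fin 2) → ℝ)
    (x : EuclideanSpace ℝ (Fin 2)) : ℝ :=
  fderiv ℝ f x (EuclideanSpace.single i 1)

/-- The Laplacian on `ℝ²`. -/
def lap2 (f : EuclideanSpace ℝ (Fin 2) → ℝ) (x : EuclideanSpace ℝ (Fin 2)) : ℝ :=
  ∑ i : Fin 2, pderiv2 i (pderiv2 i f) x

open MeasureTheory Set Metric Topology

/-- The Euclidean plane. -/
abbrev Plane := EuclideanSpace ℝ (Fin 2)

lemma finrank_plane : Module.finrank ℝ Plane = 2 := by simp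

lemma integrableOn_ball_norm_rpow {s : ℝ} (hs : -2 < s) {r : ℝ} (hr : 0 < r) :
    IntegrableOn (fun z : Plane ↦ ‖z‖ ^ s) (ball 0 r) := by
  rw [integrableOn_fun_norm_addHaar volume (f := fun t ↦ t ^ s), finrank_plane]
  refine ((intervalIntegral.integrableOn_Ioo_rpow_iff (s := s + 1) hr).2 (by linarith)).congr_fun
    (fun t ht ↦ ?_) measurableSet_Ioo
  simp [Real.rpow_add_one ht.1.ne', mul_comm]

lemma lintegral_ball_norm_rpow {s : ℝ} (hs : -2 < s) {r : ℝ} (hr : 0 < r) :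
    ∫⁻ z in ball (0 : Plane) r, ENNReal.ofReal (‖z‖ ^ s) =
      ENNReal.ofReal (2 * volume.real (ball (0 : Plane) 1) / (s + 2) * r ^ (s + 2)) := by
  rw [← ofReal_integral_eq_lintegral_ofReal (integrableOn_ball_norm_rpow hs hr)
    (ae_of_all _ fun z ↦ by positivity), ← integral_indicator measurableSet_ball]
  congr 1
  have h1 : (ball (0 : Plane) r).indicator (fun z ↦ ‖z‖ ^ s) =
      fun z ↦ (Iio r).indicator (fun t ↦ t ^ s) ‖z‖ := by
    ext z
    simp [indicator]
  have h2 : ∫ t in Ioi (0 : ℝ), t ^ (2 - 1) • (Iio r).indicator (fun t ↦ t ^ s) t =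
      r ^ (s + 2) / (s + 2) := by
    have h3 : ∀ t : ℝ, t ^ (2 - 1) • (Iio r).indicator (fun t ↦ t ^ s) t =
        (Iio r).indicator (fun t ↦ t * t ^ s) t := by
      intro t
      simp [indicator]
    simp_rw [h3]
    rw [setIntegral_indicator measurableSet_Iio, Ioi_inter_Iio, ← integral_Ioc_eq_integral_Ioo,
      ← intervalIntegral.integral_of_le hr.le]
    have h4 : ∫ t in (0 : ℝ)..r, t * t ^ s = ∫ t in (0 : ℝ)..r, t ^ (s + 1) := by
      refine intervalIntegral.integral_congr_ae (ae_of_all _ fun t ht ↦ ?_)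
      rw [uIoc_of_le hr.le] at ht
      simp [Real.rpow_add_one ht.1.ne', mul_comm]
    rw [h4, integral_rpow (Or.inl (by linarith)), show s + 1 + 1 = s + 2 by ring,
      Real.zero_rpow (by linarith), sub_zero]
  rw [h1, integral_fun_norm_addHaar, finrank_plane, h2]
  simp only [nsmul_eq_mul, smul_eq_mul]
  push_cast
  ring

lemma lintegral_compl_ball_norm_rpow {s : ℝ} (hs : s < -2) {r : ℝ} (hr : 0 < r) :
    ∫⁻ z in (ball (0 : Plane) r)ᶜ, ENNReal.ofReal (‖z‖ ^ s) =
      ENNReal.ofReal (2 * volume.real (ball (0 : Plane) 1) / (-(s + 2)) * r ^ (s + 2)) := by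
  have h1 : (ball (0 : Plane) r)ᶜ.indicator (fun z ↦ ‖z‖ ^ s) =
      fun z ↦ (Ici r).indicator (fun t ↦ t ^ s) ‖z‖ := by
    ext z
    simp [indicator]
  have h3 : (fun t : ℝ ↦ t ^ (2 - 1) • (Ici r).indicator (fun t ↦ t ^ s) t) =
      (Ici r).indicator (fun t ↦ t ^ (s + 1)) := by
    ext t
    by_cases ht : r ≤ t
    · simp [indicator, ht, Real.rpow_add_one (hr.trans_le ht).ne', mul_comm]
    · simp [indicator, ht]
  have hsub : Ici r ⊆ Ioi 0 := fun t ht ↦ hr.trans_le ht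
  have hint : IntegrableOn (fun z : Plane ↦ ‖z‖ ^ s) (ball 0 r)ᶜ := by
    rw [← integrable_indicator_iff measurableSet_ball.compl, h1, integrable_fun_norm_addHaar,
      finrank_plane, h3, integrableOn_indicator_iff measurableSet_Ici, inter_eq_left.2 hsub,
      integrableOn_Ici_iff_integrableOn_Ioi]
    exact integrableOn_Ioi_rpow_of_lt (by linarith) hr
  have h2 : ∫ t in Ioi (0 : ℝ), t ^ (2 - 1) • (Ici r).indicator (fun t ↦ t ^ s) t =
      r ^ (s + 2) / (-(s + 2)) := by
    rw [h3, setIntegral_indicator measurableSet_Ici, inter_eq_right.2 hsub,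
      integral_Ici_eq_integral_Ioi, integral_Ioi_rpow_of_lt (by linarith) hr,
      show s + 1 + 1 = s + 2 by ring, div_neg, neg_div]
  rw [← ofReal_integral_eq_lintegral_ofReal hint (ae_of_all _ fun z ↦ by positivity),
    ← integral_indicator measurableSet_ball.compl, h1, integral_fun_norm_addHaar, finrank_plane, h2]
  congr 1
  simp only [nsmul_eq_mul, smul_eq_mul]
  push_cast
  ring

/-- A smooth regularisation of the kernel `‖z‖ ^ (2 * p)`. -/
def regKernel (p t : ℝ) (z : Plane) : ℝ := (‖z‖ ^ 2 + t) ^ p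

/-- The `i`-th partial derivative of `regKernel p t`. -/
def regKernelDeriv (p t : ℝ) (i : Fin 2) (z : Plane) : ℝ :=
  2 * p * (z i * regKernel (p - 1) t z)

lemma hasFDerivAt_regKernel (p : ℝ) {t : ℝ} (ht : 0 < t) (z : Plane) :
    HasFDerivAt (regKernel p t) ((p * regKernel (p - 1) t z) • (2 • innerSL ℝ z)) z := by
  have h : HasFDerivAt (fun z : Plane ↦ ‖z‖ ^ 2 + t) (2 • innerSL ℝ z) z :=
    (hasStrictFDerivAt_norm_sq z).hasFDerivAt.add_const t
  exact h.rpow_const (Or.inl (by positivity))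

lemma continuous_regKernel (p : ℝ) {t : ℝ} (ht : 0 < t) : Continuous (regKernel p t) :=
  continuous_iff_continuousAt.2 fun z ↦ (hasFDerivAt_regKernel p ht z).continuousAt

lemma continuous_regKernelDeriv (p : ℝ) {t : ℝ} (ht : 0 < t) (i : Fin 2) :
    Continuous (regKernelDeriv p t i) := by
  have := continuous_regKernel (p - 1) ht
  unfold regKernelDeriv
  fun_prop

lemma regKernel_nonneg (p : ℝ) {t : ℝ} (ht : 0 < t) (z : Plane) : 0 ≤ regKernel p t z := by
  unfold regKernel
  positivity

lemma regKernel_le {p : ℝ} (hp : p ≤ 0) {t : ℝ} (ht : 0 < t) {z : Plane} {r : ℝ} (hr : 0 < r)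
    (hz : r ≤ ‖z‖) : regKernel p t z ≤ r ^ (2 * p) := by
  rw [Real.rpow_mul hr.le, Real.rpow_two]
  exact Real.rpow_le_rpow_of_nonpos (by positivity) (by nlinarith) hp

lemma abs_regKernelDeriv_le {p : ℝ} (hp : |2 * p| ≤ 1) {t : ℝ} (ht : 0 < t) (i : Fin 2)
    (z : Plane) : |regKernelDeriv p t i z| ≤ ‖z‖ ^ (2 * p - 1) := by
  rcases eq_or_ne z 0 with rfl | hz
  · simp only [regKernelDeriv, PiLp.zero_apply, zero_mul, mul_zero, abs_zero]
    positivity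
  have hz' : 0 < ‖z‖ := norm_pos_iff.2 hz
  have h1 := regKernel_le (p := p - 1) (by linarith [le_abs_self (2 * p)]) ht hz' le_rfl
  have h2 : |z i| ≤ ‖z‖ := by simpa using PiLp.norm_apply_le z i
  have h3 := regKernel_nonneg (p - 1) ht z
  calc |regKernelDeriv p t i z| = |2 * p| * (|z i| * regKernel (p - 1) t z) := by
        rw [regKernelDeriv, abs_mul, abs_mul (z i), abs_of_nonneg h3]
    _ ≤ 1 * (‖z‖ * ‖z‖ ^ (2 * (p - 1))) := by gcongr
    _ = ‖z‖ ^ (2 * p - 1) := by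
        rw [one_mul, mul_comm, ← Real.rpow_add_one hz'.ne']
        ring_nf

lemma norm_sub_regKernelDeriv_le {p : ℝ} (hp : |2 * p| ≤ 1) {t : ℝ} (ht : 0 < t) (i : Fin 2)
    {z w : Plane} (hw : w ≠ 0) (hzw : ‖z - w‖ ≤ ‖w‖ / 2) :
    ‖regKernelDeriv p t i z - regKernelDeriv p t i w‖ ≤
      4 * (‖w‖ / 2) ^ (2 * p - 2) * ‖z - w‖ := by
  have hw' : 0 < ‖w‖ := norm_pos_iff.2 hw
  have hd : ∀ v : Plane, HasFDerivAt (regKernelDeriv p t i)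
      ((2 * p) • (v i • (((p - 1) * regKernel (p - 1 - 1) t v) • (2 • innerSL ℝ v)) +
        regKernel (p - 1) t v • (EuclideanSpace.proj i : Plane →L[ℝ] ℝ))) v := fun v ↦
    (((EuclideanSpace.proj i : Plane →L[ℝ] ℝ).hasFDerivAt).mul
      (hasFDerivAt_regKernel (p - 1) ht v)).const_mul (2 * p)
  refine (convex_closedBall w (‖w‖ / 2)).norm_image_sub_le_of_norm_hasFDerivWithin_le
    (fun v _ ↦ (hd v).hasFDerivWithinAt) (fun v hv ↦ ?_) (mem_closedBall_self (by positivity))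
    (by simpa [dist_eq_norm] using hzw)
  have hv' : ‖w‖ / 2 ≤ ‖v‖ := by
    rw [mem_closedBall, dist_comm, dist_eq_norm] at hv
    linarith [norm_sub_norm_le w v]
  have hvi : |v i| ≤ ‖v‖ := by simpa using PiLp.norm_apply_le v i
  have hp1 : |p - 1| ≤ 3 / 2 := by
    rw [abs_le] at hp ⊢
    constructor <;> linarith
  have hproj : ‖(EuclideanSpace.proj i : Plane →L[ℝ] ℝ)‖ ≤ 1 :=
    ContinuousLinearMap.opNorm_le_bound _ zero_le_one fun v ↦ by
      simpa using PiLp.norm_apply_le v i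
  have hk0 := regKernel_nonneg (p - 1) ht v
  have hk1 := regKernel_nonneg (p - 1 - 1) ht v
  have hk : ‖v‖ ^ 2 * regKernel (p - 1 - 1) t v ≤ regKernel (p - 1) t v := by
    have hS : 0 < ‖v‖ ^ 2 + t := by positivity
    have : regKernel (p - 1) t v = (‖v‖ ^ 2 + t) * regKernel (p - 1 - 1) t v := by
      rw [regKernel, regKernel, Real.rpow_sub_one hS.ne' (p - 1)]
      field_simp
    rw [this]
    gcongr
    linarith
  have hin : ‖(2 • innerSL ℝ v : Plane →L[ℝ] ℝ)‖ ≤ 2 * ‖v‖ := by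
    rw [← Nat.cast_smul_eq_nsmul ℝ, norm_smul, innerSL_apply_norm]
    simp
  generalize (2 • innerSL ℝ v : Plane →L[ℝ] ℝ) = L at hin ⊢
  calc _ ≤ |2 * p| * (|v i| * ((|p - 1| * regKernel (p - 1 - 1) t v) * (2 * ‖v‖)) +
        regKernel (p - 1) t v * 1) := by
        rw [norm_smul, Real.norm_eq_abs]
        gcongr
        refine (norm_add_le _ _).trans ?_
        rw [norm_smul, norm_smul, norm_smul, norm_mul, Real.norm_eq_abs, Real.norm_eq_abs,
          Real.norm_of_nonneg hk1, Real.norm_of_nonneg hk0]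
        gcongr
    _ ≤ 1 * (‖v‖ * ((3 / 2 * regKernel (p - 1 - 1) t v) * (2 * ‖v‖)) +
        regKernel (p - 1) t v * 1) := by gcongr
    _ ≤ 4 * regKernel (p - 1) t v := by linarith
    _ ≤ 4 * (‖w‖ / 2) ^ (2 * (p - 1)) := by
        gcongr
        exact regKernel_le (by linarith [le_abs_self (2 * p)]) ht (by positivity) hv'
    _ = 4 * (‖w‖ / 2) ^ (2 * p - 2) := by ring_nf

lemma locallyIntegrable_norm_rpow {s : ℝ} (hs : -2 < s) :
    LocallyIntegrable (fun z : Plane ↦ ‖z‖ ^ s) := by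
  refine locallyIntegrable_of_norm_le_rpow (C := 1) (α := -s) (by simp) ?_
    (ae_of_all _ fun z ↦ ?_)
    (Measurable.aestronglyMeasurable (by fun_prop))
  · rw [finrank_plane]
    push_cast
    linarith
  · rw [Real.norm_of_nonneg (by positivity), neg_neg, one_mul]

lemma integrable_mul_norm_sub_rpow {s : ℝ} (hs : -2 < s) {v : Plane → ℝ} (hv : Continuous v)
    (hvc : HasCompactSupport v) (y : Plane) : Integrable fun x ↦ v x * ‖y - x‖ ^ s := by
  have h : Integrable fun z ↦ v (y - z) * ‖z‖ ^ s :=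
    (locallyIntegrable_norm_rpow hs).integrable_smul_left_of_hasCompactSupport
      (hv.comp (continuous_const.sub continuous_id))
      (hvc.comp_homeomorph (Homeomorph.subLeft y))
  simpa using h.comp_sub_left y

lemma contDiff_pderiv2 (i : Fin 2) {f : Plane → ℝ} (hf : ContDiff ℝ (⊤ : ℕ∞) f) :
    ContDiff ℝ (⊤ : ℕ∞) (pderiv2 i f) :=
  (hf.fderiv_right (m := (⊤ : ℕ∞)) (by norm_cast)).clm_apply contDiff_const

lemma tsupport_pderiv2_subset (i : Fin 2) (f : Plane → ℝ) :
    tsupport (pderiv2 i f) ⊆ tsupport f :=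
  tsupport_fderiv_apply_subset ℝ _

lemma hasCompactSupport_pderiv2 (i : Fin 2) {f : Plane → ℝ} (hf : HasCompactSupport f) :
    HasCompactSupport (pderiv2 i f) :=
  hf.fderiv_apply ℝ _

lemma integral_pderiv2_mul (i : Fin 2) {f g : Plane → ℝ} (hf : ContDiff ℝ (⊤ : ℕ∞) f)
    (hfc : HasCompactSupport f) (hg : Differentiable ℝ g) (hg' : Continuous (pderiv2 i g)) :
    ∫ x, pderiv2 i f x * g x = -∫ x, f x * pderiv2 i g x := by
  have h1 := (contDiff_pderiv2 i hf).continuous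
  rw [eq_comm, neg_eq_iff_eq_neg]
  exact integral_mul_fderiv_eq_neg_fderiv_mul_of_integrable
    ((h1.mul hg.continuous).integrable_of_hasCompactSupport
      (hasCompactSupport_pderiv2 i hfc).mul_right)
    ((hf.continuous.mul hg').integrable_of_hasCompactSupport hfc.mul_right)
    ((hf.continuous.mul hg.continuous).integrable_of_hasCompactSupport hfc.mul_right)
    (fun x _ ↦ (hf.differentiable (by simp)) x) (fun x _ ↦ hg x)

lemma integral_pderiv2_eq_zero (i : Fin 2) {f : Plane → ℝ} (hf : ContDiff ℝ (⊤ : ℕ∞) f)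
    (hfc : HasCompactSupport f) : ∫ x, pderiv2 i f x = 0 := by
  have h : pderiv2 i (fun _ : Plane ↦ (1 : ℝ)) = 0 := by
    ext x
    simp [pderiv2]
  simpa [h] using integral_pderiv2_mul i hf hfc (g := fun _ ↦ 1) (by fun_prop)
    (by rw [h]; exact continuous_zero)

lemma contDiff_lap2 {f : Plane → ℝ} (hf : ContDiff ℝ (⊤ : ℕ∞) f) :
    ContDiff ℝ (⊤ : ℕ∞) (lap2 f) :=
  ContDiff.sum fun i _ ↦ contDiff_pderiv2 i (contDiff_pderiv2 i hf)

lemma support_lap2_subset (f : Plane → ℝ) : Function.support (lap2 f) ⊆ tsupport f := by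
  intro x hx
  by_contra hxf
  refine hx (Finset.sum_eq_zero fun i _ ↦ image_eq_zero_of_notMem_tsupport fun h ↦ hxf ?_)
  exact tsupport_pderiv2_subset i f (tsupport_pderiv2_subset i _ h)

lemma integral_lap2_eq_zero {f : Plane → ℝ} (hf : ContDiff ℝ (⊤ : ℕ∞) f)
    (hfc : HasCompactSupport f) : ∫ x, lap2 f x = 0 := by
  have hi := fun i ↦ contDiff_pderiv2 i hf
  have hci := fun i ↦ hasCompactSupport_pderiv2 i hfc
  unfold lap2
  rw [integral_finsetSum _ fun i _ ↦
    (contDiff_pderiv2 i (hi i)).continuous.integrable_of_hasCompactSupport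
      (hasCompactSupport_pderiv2 i (hci i))]
  exact Finset.sum_eq_zero fun i _ ↦ integral_pderiv2_eq_zero i (hi i) (hci i)

lemma integral_pderiv2_mul_regKernel (i : Fin 2) {u : Plane → ℝ} (hu : ContDiff ℝ (⊤ : ℕ∞) u)
    (huc : HasCompactSupport u) (p : ℝ) {t : ℝ} (ht : 0 < t) (y : Plane) :
    ∫ x, pderiv2 i u x * regKernel p t (y - x) = ∫ x, u x * regKernelDeriv p t i (y - x) := by
  have hd : ∀ x, HasFDerivAt (fun x ↦ regKernel p t (y - x)) _ x := fun x ↦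
    (hasFDerivAt_regKernel p ht (y - x)).comp x ((hasFDerivAt_id x).const_sub y)
  have hp : pderiv2 i (fun x ↦ regKernel p t (y - x)) = fun x ↦ -regKernelDeriv p t i (y - x) := by
    ext x
    rw [pderiv2, (hd x).fderiv]
    simp [regKernelDeriv, EuclideanSpace.inner_single_right]
    ring
  rw [integral_pderiv2_mul i hu huc (fun x ↦ (hd x).differentiableAt), hp]
  · simp [integral_neg]
  · rw [hp]
    exact ((continuous_regKernelDeriv p ht i).comp (by fun_prop)).neg

/-- Uniform bounds for the regularised convolutions pass to the limit kernel. -/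
lemma enorm_integral_mul_norm_rpow_le {p : ℝ} (hp : -1 < p) (hp0 : p ≤ 0) {v : Plane → ℝ}
    (hv : Continuous v) (hvc : HasCompactSupport v) (y : Plane) {B : ENNReal}
    (hB : ∀ t : ℝ, 0 < t → ‖∫ x, v x * regKernel p t (y - x)‖ₑ ≤ B) :
    ‖∫ x, v x * ‖y - x‖ ^ (2 * p)‖ₑ ≤ B := by
  have hne : ∀ᵐ x : Plane, x ≠ y := by simp [ae_iff]
  have hlim : Filter.Tendsto (fun t ↦ ∫ x, v x * regKernel p t (y - x)) (𝓝[>] 0)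
      (𝓝 (∫ x, v x * ‖y - x‖ ^ (2 * p))) := by
    refine tendsto_integral_filter_of_dominated_convergence
      (fun x ↦ ‖v x * ‖y - x‖ ^ (2 * p)‖) ?_ ?_
      (integrable_mul_norm_sub_rpow (by linarith) hv hvc y).norm ?_
    · filter_upwards [self_mem_nhdsWithin] with t ht
      exact (hv.mul ((continuous_regKernel p ht).comp (by fun_prop))).aestronglyMeasurable
    · filter_upwards [self_mem_nhdsWithin] with t ht
      filter_upwards [hne] with x hx
      rw [norm_mul, norm_mul, Real.norm_of_nonneg (regKernel_nonneg p ht _),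
        Real.norm_of_nonneg (by positivity : 0 ≤ ‖y - x‖ ^ (2 * p))]
      gcongr
      exact regKernel_le hp0 ht (norm_pos_iff.2 (sub_ne_zero.2 hx.symm)) le_rfl
    · filter_upwards [hne] with x hx
      have hyx : 0 < ‖y - x‖ := norm_pos_iff.2 (sub_ne_zero.2 hx.symm)
      refine tendsto_nhdsWithin_of_tendsto_nhds (Filter.Tendsto.const_mul _ ?_)
      have hc : ContinuousAt (fun t : ℝ ↦ (‖y - x‖ ^ 2 + t) ^ p) 0 :=
        ContinuousAt.rpow_const (by fun_prop) (Or.inl (by positivity))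
      have h0 := hc.tendsto
      rw [add_zero, ← Real.rpow_two, ← Real.rpow_mul hyx.le] at h0
      simpa [regKernel] using h0
  refine le_of_tendsto ((continuous_enorm.tendsto _).comp hlim) ?_
  filter_upwards [self_mem_nhdsWithin] with t ht using hB t ht

/-- The near-field majorant of the differentiated kernel. -/
def nearKernel (p r : ℝ) : Plane → ENNReal :=
  (ball 0 (6 * r)).indicator fun z ↦ ENNReal.ofReal (‖z‖ ^ (2 * p - 1))

/-- The far-field majorant, gaining one power of decay from the vanishing mean. -/
def farKernel (p r : ℝ) : Plane → ENNReal :=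
  (ball 0 (4 * r))ᶜ.indicator fun z ↦ ENNReal.ofReal (64 * r) * ENNReal.ofReal (‖z‖ ^ (2 * p - 2))

lemma measurable_nearKernel (p r : ℝ) : Measurable (nearKernel p r) :=
  Measurable.indicator (by fun_prop) measurableSet_ball

lemma measurable_farKernel (p r : ℝ) : Measurable (farKernel p r) :=
  Measurable.indicator (by fun_prop) measurableSet_ball.compl

lemma enorm_integral_mul_regKernelDeriv_le_near {p : ℝ} (hp : |2 * p| ≤ 1) {t : ℝ} (ht : 0 < t)
    (i : Fin 2) {u : Plane → ℝ} {a : Plane} {r : ℝ} (hsupp : ∀ x, u x ≠ 0 → ‖x - a‖ ≤ 2 * r)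
    {y : Plane} (hy : ‖y - a‖ < 4 * r) :
    ‖∫ x, u x * regKernelDeriv p t i (y - x)‖ₑ ≤ ∫⁻ x, ‖u x‖ₑ * nearKernel p r (y - x) := by
  refine (enorm_integral_le_lintegral_enorm _).trans (lintegral_mono fun x ↦ ?_)
  rcases eq_or_ne (u x) 0 with hx | hx
  · simp [hx]
  have hyx : y - x ∈ ball (0 : Plane) (6 * r) := by
    rw [mem_ball_zero_iff, ← sub_sub_sub_cancel_right y x a]
    linarith [norm_sub_le (y - a) (x - a), hsupp x hx]
  rw [enorm_mul, nearKernel, indicator_of_mem hyx]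
  gcongr
  rw [Real.enorm_eq_ofReal_abs]
  exact ENNReal.ofReal_le_ofReal (abs_regKernelDeriv_le hp ht i _)

lemma enorm_integral_mul_regKernelDeriv_le_far {p : ℝ} (hp : |2 * p| ≤ 1) {t : ℝ} (ht : 0 < t)
    (i : Fin 2) {u : Plane → ℝ} (hu : Continuous u) (huc : HasCompactSupport u)
    (hu0 : ∫ x, u x = 0) (hu1 : ∫ x, |u x| ≤ 1) {a : Plane} {r : ℝ} (hr : 0 < r)
    (hsupp : ∀ x, u x ≠ 0 → ‖x - a‖ ≤ 2 * r) {y : Plane} (hy : 4 * r ≤ ‖y - a‖) :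
    ‖∫ x, u x * regKernelDeriv p t i (y - x)‖ₑ ≤ farKernel p r (y - a) := by
  have hya : y - a ∉ ball (0 : Plane) (4 * r) := by simpa using hy
  have hy0 : 0 < ‖y - a‖ := by linarith
  have hint : Integrable u := hu.integrable_of_hasCompactSupport huc
  have hK := continuous_regKernelDeriv p ht i
  have hsub : ∫ x, u x * regKernelDeriv p t i (y - x) =
      ∫ x, u x * (regKernelDeriv p t i (y - x) - regKernelDeriv p t i (y - a)) := by
    simp_rw [mul_sub]
    rw [integral_sub, integral_mul_const, hu0, zero_mul, sub_zero]
    · exact (hu.mul (hK.comp (by fun_prop))).integrable_of_hasCompactSupport huc.mul_right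
    · exact hint.mul_const _
  have hpow : (‖y - a‖ / 2) ^ (2 * p - 2) ≤ 8 * ‖y - a‖ ^ (2 * p - 2) := by
    rw [div_eq_inv_mul, Real.mul_rpow (by norm_num) hy0.le, Real.inv_rpow (by norm_num),
      ← Real.rpow_neg (by norm_num)]
    gcongr
    calc (2 : ℝ) ^ (-(2 * p - 2)) ≤ 2 ^ (3 : ℝ) :=
          Real.rpow_le_rpow_of_exponent_le (by norm_num) (by linarith [(abs_le.1 hp).1])
      _ = 8 := by norm_num
  have hbound : ∀ x, ‖u x * (regKernelDeriv p t i (y - x) - regKernelDeriv p t i (y - a))‖ ≤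
      |u x| * (64 * r * ‖y - a‖ ^ (2 * p - 2)) := by
    intro x
    rcases eq_or_ne (u x) 0 with hx | hx
    · simp [hx]
    have hxa : ‖(y - x) - (y - a)‖ ≤ 2 * r := by
      rw [sub_sub_sub_cancel_left, norm_sub_rev]
      exact hsupp x hx
    rw [norm_mul, Real.norm_eq_abs (u x)]
    gcongr
    calc _ ≤ 4 * (‖y - a‖ / 2) ^ (2 * p - 2) * ‖(y - x) - (y - a)‖ :=
          norm_sub_regKernelDeriv_le hp ht i (norm_pos_iff.1 hy0) (by linarith)
      _ ≤ 4 * (8 * ‖y - a‖ ^ (2 * p - 2)) * (2 * r) := by gcongr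
      _ = 64 * r * ‖y - a‖ ^ (2 * p - 2) := by ring
  rw [farKernel, indicator_of_mem hya, ← ENNReal.ofReal_mul (by positivity), hsub,
    ← ofReal_norm]
  refine ENNReal.ofReal_le_ofReal ((norm_integral_le_of_norm_le (hint.abs.mul_const _)
    (ae_of_all _ hbound)).trans ?_)
  rw [integral_mul_const]
  exact mul_le_of_le_one_left (by positivity) hu1

/-- If `u` has mean zero, `∫ |u| ≤ 1` and support within distance `2 * r` of `a`, then the
convolution of `∂ᵢ u` with `‖z‖ ^ (2 * p)` has `L¹` norm `O(r ^ (2 * p + 1))`. -/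
lemma lintegral_enorm_conv_pderiv2_le {p : ℝ} (hp0 : -1 / 2 < p) (hp1 : p < 0) (i : Fin 2)
    {u : Plane → ℝ} (hu : ContDiff ℝ (⊤ : ℕ∞) u) (huc : HasCompactSupport u)
    (hu0 : ∫ x, u x = 0) (hu1 : ∫ x, |u x| ≤ 1) {a : Plane} {r : ℝ} (hr : 0 < r)
    (hsupp : ∀ x, u x ≠ 0 → ‖x - a‖ ≤ 2 * r) :
    ∫⁻ y, ‖∫ x, pderiv2 i u x * ‖y - x‖ ^ (2 * p)‖ₑ ≤
      ENNReal.ofReal ((2 * volume.real (ball (0 : Plane) 1) / (2 * p + 1) * 6 ^ (2 * p + 1) +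
        64 * (2 * volume.real (ball (0 : Plane) 1) / (-(2 * p)) * 4 ^ (2 * p))) *
        r ^ (2 * p + 1)) := by
  have hp : |2 * p| ≤ 1 := by
    rw [abs_le]
    constructor <;> linarith
  have hpt : ∀ y, ‖∫ x, pderiv2 i u x * ‖y - x‖ ^ (2 * p)‖ₑ ≤
      (∫⁻ x, ‖u x‖ₑ * nearKernel p r (y - x)) + farKernel p r (y - a) := by
    intro y
    refine enorm_integral_mul_norm_rpow_le (by linarith) hp1.le (contDiff_pderiv2 i hu).continuous
      (hasCompactSupport_pderiv2 i huc) y fun t ht ↦ ?_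
    rw [integral_pderiv2_mul_regKernel i hu huc p ht y]
    rcases lt_or_ge ‖y - a‖ (4 * r) with hy | hy
    · exact (enorm_integral_mul_regKernelDeriv_le_near hp ht i hsupp hy).trans le_self_add
    · exact (enorm_integral_mul_regKernelDeriv_le_far hp ht i hu.continuous huc hu0 hu1 hr hsupp
        hy).trans le_add_self
  have hum : Measurable fun x ↦ ‖u x‖ₑ := hu.continuous.measurable.enorm
  have hnm := measurable_nearKernel p r
  have hu1' : ∫⁻ x, ‖u x‖ₑ ≤ 1 := by
    rw [← ofReal_integral_norm_eq_lintegral_enorm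
      (hu.continuous.integrable_of_hasCompactSupport huc)]
    exact ENNReal.ofReal_le_one.2 hu1
  have hnear : ∫⁻ y, ∫⁻ x, ‖u x‖ₑ * nearKernel p r (y - x) ≤ ∫⁻ z, nearKernel p r z := by
    rw [lintegral_lintegral_swap (by fun_prop)]
    calc _ = ∫⁻ x, ‖u x‖ₑ * ∫⁻ z, nearKernel p r z := by
          congr with x
          rw [lintegral_const_mul _ (by fun_prop), lintegral_sub_right_eq_self]
      _ ≤ 1 * ∫⁻ z, nearKernel p r z := by
          rw [lintegral_mul_const _ hum]
          gcongr
      _ = _ := one_mul _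
  have hfm : Measurable fun y ↦ farKernel p r (y - a) :=
    (measurable_farKernel p r).comp (by fun_prop)
  refine (lintegral_mono hpt).trans ?_
  rw [lintegral_add_right _ hfm,
    lintegral_sub_right_eq_self (farKernel p r) a, add_mul, ENNReal.ofReal_add]
  · refine add_le_add (hnear.trans_eq ?_) (Eq.le ?_)
    · rw [nearKernel, lintegral_indicator measurableSet_ball,
        lintegral_ball_norm_rpow (by linarith) (by positivity),
        show 2 * p - 1 + 2 = 2 * p + 1 by ring, Real.mul_rpow (by norm_num) hr.le, mul_assoc]
    · rw [farKernel, lintegral_indicator measurableSet_ball.compl,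
        lintegral_const_mul _ (by fun_prop),
        lintegral_compl_ball_norm_rpow (by linarith) (by positivity),
        ← ENNReal.ofReal_mul (by positivity), show 2 * p - 2 + 2 = 2 * p by ring,
        Real.mul_rpow (by norm_num) hr.le, Real.rpow_add_one hr.ne']
      ring_nf
  · have : 0 < 2 * p + 1 := by linarith
    positivity
  · have : 0 < -(2 * p) := by linarith
    positivity

lemma norm_sub_le_of_mem_square {a x : Plane} {r : ℝ} (hr : 0 < r)
    (hx : ∀ i : Fin 2, x i ∈ Icc (a i) (a i + r)) : ‖x - a‖ ≤ 2 * r := by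
  refine abs_le_of_sq_le_sq' ?_ (by positivity) |>.2
  rw [EuclideanSpace.real_norm_sq_eq, Fin.sum_univ_two]
  have h0 := hx 0
  have h1 := hx 1
  simp only [mem_Icc, PiLp.sub_apply] at h0 h1 ⊢
  nlinarith

/-- For `0 < α < 1` there is `C = C(α) > 0` such that for every axis-parallel square
`Q ⊂ ℝ²` of side length `ℓ > 0`, every `f ∈ C_c^∞(ℝ²)` supported in `Q` with
`‖Δf‖_{L¹} ≤ 1`, and each `i ∈ {1,2}`:
`∫ |((∂_i Δ f) * |·|^{α-1})(y)| dy ≤ C ℓ^α`. -/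
theorem stmt14 (α : ℝ) (hα0 : 0 < α) (hα1 : α < 1) :
    ∃ C : ℝ, 0 < C ∧
      ∀ (a : EuclideanSpace ℝ (Fin 2)) (ℓ : ℝ), 0 < ℓ →
        ∀ f : EuclideanSpace ℝ (Fin 2) → ℝ, ContDiff ℝ (⊤ : ℕ∞) f → HasCompactSupport f →
          tsupport f ⊆ {x | ∀ i : Fin 2, x i ∈ Set.Icc (a i) (a i + ℓ)} →
          (∫ x, |lap2 f x|) ≤ 1 →
          ∀ i : Fin 2,
            (∫ y, |∫ x, pderiv2 i (lap2 f) x * ‖y - x‖ ^ (α - 1)|) ≤ C * ℓ ^ α := by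
  have hα' : 2 * ((α - 1) / 2) = α - 1 := by ring
  have hαp : 0 < 2 * ((α - 1) / 2) + 1 := by linarith
  have hαn : 0 < -(2 * ((α - 1) / 2)) := by linarith
  refine ⟨2 * volume.real (ball (0 : Plane) 1) / (2 * ((α - 1) / 2) + 1) *
      6 ^ (2 * ((α - 1) / 2) + 1) + 64 * (2 * volume.real (ball (0 : Plane) 1) /
      (-(2 * ((α - 1) / 2))) * 4 ^ (2 * ((α - 1) / 2))), ?_, ?_⟩
  · have hV : 0 < volume.real (ball (0 : Plane) 1) :=
      ENNReal.toReal_pos (measure_ball_pos _ _ one_pos).ne' measure_ball_lt_top.ne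
    positivity
  intro a ℓ hℓ f hf hfc hsq hf1 i
  have hlapc : HasCompactSupport (lap2 f) := hfc.mono' (support_lap2_subset f)
  have h := lintegral_enorm_conv_pderiv2_le (p := (α - 1) / 2) (by linarith) (by linarith) i
    (contDiff_lap2 hf) hlapc (integral_lap2_eq_zero hf hfc) hf1 hℓ
    (fun x hx ↦ norm_sub_le_of_mem_square hℓ (hsq (support_lap2_subset f hx)))
  rw [← ENNReal.ofReal_le_ofReal_iff (by positivity)]
  refine (ENNReal.ofReal_le_ofReal (le_abs_self _)).trans ?_
  rw [← Real.enorm_eq_ofReal_abs]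
  refine (enorm_integral_le_lintegral_enorm _).trans ?_
  simp_rw [← Real.norm_eq_abs, enorm_norm]
  rwa [hα', sub_add_cancel] at h ⊢

end
end

section
/- Let m ≥ 1 be an integer and 0 < α < 1. The function f(s) = s^m / ((s+1)^{m/(m+α−1)} − 1)^{m+α−1} is strictly increasing on (0, ∞); equivalently, g₁(s) = 1 − s^m/((s+1)^{m/(m+α−1)} − 1)^{m+α−1} is strictly decreasing on (0, ∞). -/
/-- Increments of a fixed length of a strictly convex function are strictly increasing. -/
theorem StrictConvexOn.sub_lt_sub_of_lt {S : Set ℝ} {f : ℝ → ℝ} (hf : StrictConvexOn ℝ S f)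
    {x y h : ℝ} (hx : x ∈ S) (hyh : y + h ∈ S) (hxy : x < y) (hh : 0 < h) :
    f (x + h) - f x < f (y + h) - f y := by
  have hd : 0 < y - x + h := by linarith
  have ha : 0 < (y - x) / (y - x + h) := div_pos (by linarith) hd
  have hb : 0 < h / (y - x + h) := div_pos hh hd
  have hab : (y - x) / (y - x + h) + h / (y - x + h) = 1 := by field_simp
  have h₁ := hf.2 hx hyh (by linarith : x ≠ y + h) ha hb hab
  have h₂ := hf.2 hx hyh (by linarith : x ≠ y + h) hb ha ((add_comm _ _).trans hab)
  simp only [smul_eq_mul] at h₁ h₂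
  have e₁ : (y - x) / (y - x + h) * x + h / (y - x + h) * (y + h) = x + h := by
    field_simp; ring
  have e₂ : h / (y - x + h) * x + (y - x) / (y - x + h) * (y + h) = y := by
    field_simp; ring
  rw [e₁] at h₁
  rw [e₂] at h₂
  linear_combination h₁ + h₂ + (f x + f (y + h)) * hab

theorem Real.rpow_div_add_one_rpow_sub_one_lt {p x y : ℝ} (hp : 1 < p) (hx : 0 < x)
    (hxy : x < y) :
    x ^ p / ((x + 1) ^ p - 1) < y ^ p / ((y + 1) ^ p - 1) := by
  have hy : 0 < y := hx.trans hxy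
  have hpos : ∀ z : ℝ, 0 < z → 0 < (z + 1) ^ p - 1 := fun z hz =>
    sub_pos.2 (Real.one_lt_rpow (by linarith) (by linarith))
  rw [div_lt_div_iff₀ (hpos x hx) (hpos y hy), mul_sub, mul_sub, mul_one, mul_one,
    ← Real.mul_rpow hx.le (by linarith), ← Real.mul_rpow hy.le (by linarith)]
  have key := (strictConvexOn_rpow hp).sub_lt_sub_of_lt (x := x) (y := y) (h := x * y)
    (Set.mem_Ici.2 hx.le) (Set.mem_Ici.2 (by positivity)) hxy (mul_pos hx hy)
  rwa [mul_add_one x, mul_add_one y, mul_comm y x, add_comm _ x, add_comm _ y]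

theorem strictMonoOn_pow_div_add_one_rpow_sub_one_rpow {m : ℕ} {b : ℝ} (hb : 0 < b)
    (hbm : b < m) :
    StrictMonoOn (fun s : ℝ => s ^ m / ((s + 1) ^ ((m : ℝ) / b) - 1) ^ b) (Set.Ioi 0) := by
  have hp : 1 < (m : ℝ) / b := (one_lt_div hb).2 hbm
  have hpos : ∀ z : ℝ, 0 < z → 0 < (z + 1) ^ ((m : ℝ) / b) - 1 := fun z hz =>
    sub_pos.2 (Real.one_lt_rpow (by linarith) (by linarith))
  have heq : ∀ z : ℝ, 0 < z → z ^ m / ((z + 1) ^ ((m : ℝ) / b) - 1) ^ b =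
      (z ^ ((m : ℝ) / b) / ((z + 1) ^ ((m : ℝ) / b) - 1)) ^ b := fun z hz => by
    rw [Real.div_rpow (by positivity) (hpos z hz).le, ← Real.rpow_mul hz.le,
      div_mul_cancel₀ _ hb.ne', Real.rpow_natCast]
  intro x (hx : 0 < x) y (hy : 0 < y) hxy
  simp only [heq x hx, heq y hy]
  exact Real.rpow_lt_rpow (div_nonneg (by positivity) (hpos x hx).le)
    (Real.rpow_div_add_one_rpow_sub_one_lt hp hx hxy) hb

/-- For an integer `m ≥ 1` and `0 < α < 1`, the function
`f(s) = s^m / ((s+1)^{m/(m+α-1)} - 1)^{m+α-1}` is strictly increasing on `(0,∞)`;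
equivalently, `g₁(s) = 1 - f(s)` is strictly decreasing on `(0,∞)`. -/
theorem stmt15 (m : ℕ) (hm : 1 ≤ m) (α : ℝ) (hα0 : 0 < α) (hα1 : α < 1) :
    StrictMonoOn
        (fun s : ℝ =>
          s ^ m / ((s + 1) ^ ((m : ℝ) / ((m : ℝ) + α - 1)) - 1) ^ ((m : ℝ) + α - 1))
        (Set.Ioi 0) ∧
      StrictAntiOn
        (fun s : ℝ =>
          1 - s ^ m / ((s + 1) ^ ((m : ℝ) / ((m : ℝ) + α - 1)) - 1) ^ ((m : ℝ) + α - 1))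
        (Set.Ioi 0) := by
  have hm' : (1 : ℝ) ≤ m := by exact_mod_cast hm
  have hmono := strictMonoOn_pow_div_add_one_rpow_sub_one_rpow (m := m) (b := (m : ℝ) + α - 1)
    (by linarith) (by linarith)
  exact ⟨hmono, fun x hx y hy hxy => sub_lt_sub_left (hmono hx hy hxy) 1⟩
end
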